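/- arXiv:1502.06396 — 3 statements merged into one kernel-verified Lean document; each statement's English description precedes it below -/
import Mathlib

section
/- Let α be a complex number that is algebraic over ℚ with α ≠ 0 and α ≠ 1. Then the complex logarithm log α is transcendental over ℚ. In particular, for every real algebraic number α with α > 0 and α ≠ 1, the real logarithm ln α is transcendental over ℚ. -/
open Polynomial Filter
open scoped Nat Topology

/-- A finite set of nonzero algebraic elements is annihilated by an integer polynomial with nonzero
constant term. -/
theorem exists_intPolynomial_eval_zero_ne_zero_of_isAlgebraic {L : Type*} [Field L]
    (s : Finset L) (halg : ∀ x ∈ s, IsAlgebraic ℤ x) (h0 : (0 : L) ∉ s) :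
    ∃ f : ℤ[X], f.eval 0 ≠ 0 ∧ ∀ x ∈ s, aeval x f = 0 := by
  have key : ∀ x : s, ∃ q : ℤ[X], q.coeff 0 ≠ 0 ∧ aeval (x : L) q = 0 := fun x =>
    (halg x x.2).exists_nonzero_coeff_and_aeval_eq_zero
      (mem_nonZeroDivisors_of_ne_zero fun h => h0 (h ▸ x.2))
  choose q hq0 hq using key
  refine ⟨∏ x, q x, ?_, fun x hx => ?_⟩
  · simp only [eval_prod, Finset.prod_ne_zero_iff, ← coeff_zero_eq_eval_zero]
    exact fun x _ => hq0 x
  · rw [map_prod]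
    exact Finset.prod_eq_zero (Finset.mem_univ ⟨x, hx⟩) (hq ⟨x, hx⟩)

/-- If `l * x` is integral then so is `l ^ N * g(x)` for every integer polynomial `g` of degree at
most `N`. -/
theorem isIntegral_pow_mul_aeval {A : Type*} [CommRing A] {l : ℤ} {x : A}
    (hx : IsIntegral ℤ ((l : A) * x)) {g : ℤ[X]} {N : ℕ} (hg : g.natDegree ≤ N) :
    IsIntegral ℤ ((l : A) ^ N * aeval x g) := by
  rw [aeval_eq_sum_range' (Nat.lt_succ_of_le hg), Finset.mul_sum]
  refine IsIntegral.sum _ fun i hi => ?_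
  have hi : i ≤ N := Nat.lt_succ_iff.mp (Finset.mem_range.mp hi)
  have : (l : A) ^ N * (g.coeff i • x ^ i) =
      ((g.coeff i * l ^ (N - i) : ℤ) : A) * ((l : A) * x) ^ i := by
    rw [zsmul_eq_mul, mul_pow, ← Nat.sub_add_cancel hi, pow_add, Nat.add_sub_cancel]
    push_cast
    ring
  rw [this]
  exact (isIntegral_algebraMap (R := ℤ) (A := A)).mul (hx.pow i)

/-- The evaluation `∑ bₓ [x] ↦ ∑ bₓ exp x` on the group ring of the additive group of `L`. -/
noncomputable def AddMonoidAlgebra.expEval (L : Type*) [Field L] [Algebra L ℂ] :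
    AddMonoidAlgebra ℤ L →ₐ[ℤ] ℂ :=
  AddMonoidAlgebra.lift ℤ ℂ L
    (Complex.expMonoidHom.comp (AddMonoidHom.toMultiplicative (algebraMap L ℂ).toAddMonoidHom))

theorem AddMonoidAlgebra.expEval_single {L : Type*} [Field L] [Algebra L ℂ] (x : L) (k : ℤ) :
    expEval L (single x k) = k * Complex.exp (algebraMap L ℂ x) := by
  simp [expEval, AddMonoidAlgebra.lift_single]

theorem AddMonoidAlgebra.expEval_apply {L : Type*} [Field L] [Algebra L ℂ]
    (F : AddMonoidAlgebra ℤ L) :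
    expEval L F = ∑ x ∈ F.coeff.support, (F.coeff x : ℂ) * Complex.exp (algebraMap L ℂ x) := by
  simp [expEval, AddMonoidAlgebra.lift_apply, Finsupp.sum]

section Galois

variable {L : Type*} [Field L] [CharZero L] [FiniteDimensional ℚ L] [IsGalois ℚ L]

/-- An integral element of a Galois extension of `ℚ` fixed by the Galois group is an integer. -/
theorem exists_intCast_eq_of_isIntegral_of_fixed {x : L} (hx : IsIntegral ℤ x)
    (hfix : ∀ τ : L ≃ₐ[ℚ] L, τ x = x) : ∃ m : ℤ, (m : L) = x := by
  obtain ⟨q, rfl⟩ := (IsGalois.mem_range_algebraMap_iff_fixed (F := ℚ) x).mpr hfix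
  rw [isIntegral_algebraMap_iff (algebraMap ℚ L).injective] at hx
  obtain ⟨m, rfl⟩ := IsIntegrallyClosed.isIntegral_iff.mp hx
  exact ⟨m, by simp⟩

/-- A Galois-invariant integer combination of exponentials of nonzero algebraic numbers is never
equal to a nonzero integer. -/
theorem intCast_add_sum_mul_exp_ne_zero [Algebra L ℂ] (s : Finset L) (h0 : (0 : L) ∉ s) (b : L → ℤ)
    (hs : ∀ (τ : L ≃ₐ[ℚ] L), ∀ x ∈ s, τ x ∈ s) (hb : ∀ (τ : L ≃ₐ[ℚ] L) (x : L), b (τ x) = b x)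
    {w : ℤ} (hw : w ≠ 0) :
    (w : ℂ) + ∑ x ∈ s, (b x : ℂ) * Complex.exp (algebraMap L ℂ x) ≠ 0 := by
  intro hsum
  have halg : ∀ x : L, IsAlgebraic ℤ x := fun x =>
    (IsFractionRing.isAlgebraic_iff ℤ ℚ L).mpr (.of_finite ℚ x)
  have : Algebra.IsAlgebraic ℤ L := ⟨halg⟩
  obtain ⟨f, hf0, hf⟩ :=
    exists_intPolynomial_eval_zero_ne_zero_of_isAlgebraic s (fun x _ => halg x) h0
  obtain ⟨l, hl0, hl⟩ := Algebra.IsAlgebraic.exists_integral_multiples ℤ s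
  obtain ⟨c, hc⟩ := LindemannWeierstrass.exp_polynomial_approx f hf0
  have hf_ne : f ≠ 0 := by rintro rfl; simp at hf0
  set d := f.natDegree
  set B : ℝ := ∑ x ∈ s, ‖(b x : ℂ)‖
  set C : ℝ := |(l : ℝ)| ^ d * c
  have hlim : Tendsto (fun k : ℕ => B * C * (C ^ k / k !)) atTop (𝓝 0) := by
    simpa using (FloorSemiring.tendsto_pow_div_factorial_atTop C).const_mul (B * C)
  obtain ⟨k₀, hk₀⟩ := eventually_atTop.mp (hlim.eventually_lt_const one_pos)
  obtain ⟨p, hp_ge, hp⟩ := Nat.exists_infinite_primes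
    (k₀ + (f.eval 0).natAbs + w.natAbs + l.natAbs + 2)
  obtain ⟨n, hn, g, hg, hr⟩ := hc p (by omega) hp
  obtain ⟨m, hm⟩ : ∃ m : ℤ, (m : L) =
      (l : L) ^ (p * d) * ∑ x ∈ s, (b x : L) * aeval x g := by
    refine exists_intCast_eq_of_isIntegral_of_fixed ?_ fun τ => ?_
    · rw [Finset.mul_sum]
      refine IsIntegral.sum _ fun x hx => ?_
      rw [mul_left_comm]
      refine (isIntegral_algebraMap (R := ℤ) (A := L) (x := b x)).mul ?_
      exact isIntegral_pow_mul_aeval (by simpa using hl x hx) (hg.trans (Nat.sub_le _ _))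
    · rw [map_mul, map_pow, map_intCast, map_sum]
      congr 1
      refine Finset.sum_nbij' (fun x => τ x) (fun x => τ.symm x) (hs τ) (hs τ.symm)
        (by simp) (by simp) fun x _ => ?_
      rw [map_mul, map_intCast, hb]
      exact congrArg _
        (aeval_algHom_apply ((τ.restrictScalars ℤ : L ≃ₐ[ℤ] L) : L →ₐ[ℤ] L) x g).symm
  have hmC : (m : ℂ) = (l : ℂ) ^ (p * d) *
      ∑ x ∈ s, (b x : ℂ) * aeval (algebraMap L ℂ x) g := by
    simpa [aeval_algebraMap_apply] using congrArg (algebraMap L ℂ) hm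
  set z : ℤ := n * w * l ^ (p * d) + p * m
  have hz : (z : ℂ) = -((l : ℂ) ^ (p * d) * ∑ x ∈ s, (b x : ℂ) *
      (n • Complex.exp (algebraMap L ℂ x) - p • aeval (algebraMap L ℂ x) g)) := by
    have hsplit : ∑ x ∈ s, (b x : ℂ) *
        (n • Complex.exp (algebraMap L ℂ x) - p • aeval (algebraMap L ℂ x) g) =
        n * ∑ x ∈ s, (b x : ℂ) * Complex.exp (algebraMap L ℂ x) -
          p * ∑ x ∈ s, (b x : ℂ) * aeval (algebraMap L ℂ x) g := by
      rw [Finset.mul_sum, Finset.mul_sum, ← Finset.sum_sub_distrib]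
      refine Finset.sum_congr rfl fun x _ => ?_
      rw [zsmul_eq_mul, nsmul_eq_mul]
      ring
    rw [hsplit]
    push_cast [z]
    rw [hmC]
    linear_combination (n : ℂ) * (l : ℂ) ^ (p * d) * hsum
  have hz_lt : ‖(z : ℂ)‖ < 1 := by
    have hsum_le : ‖∑ x ∈ s, (b x : ℂ) *
        (n • Complex.exp (algebraMap L ℂ x) - p • aeval (algebraMap L ℂ x) g)‖ ≤
        B * (c ^ p / (p - 1)!) := by
      rw [Finset.sum_mul]
      refine norm_sum_le_of_le _ fun x hx => ?_
      rw [norm_mul]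
      refine mul_le_mul_of_nonneg_left (hr ?_) (norm_nonneg _)
      rw [mem_aroots]
      exact ⟨hf_ne, by rw [aeval_algebraMap_apply, hf x hx, map_zero]⟩
    calc ‖(z : ℂ)‖ ≤ |(l : ℝ)| ^ (p * d) * (B * (c ^ p / (p - 1)!)) := by
          rw [hz, norm_neg, norm_mul, norm_pow, Complex.norm_intCast]
          gcongr
      _ = B * C * (C ^ (p - 1) / (p - 1)!) := by
          have : C ^ p = C * C ^ (p - 1) := by
            rw [← pow_succ', Nat.sub_add_cancel hp.one_le]
          rw [mul_assoc B, ← mul_div_assoc C, ← this, mul_pow, ← pow_mul, mul_comm d p]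
          ring
      _ < 1 := hk₀ _ (by omega)
  have hz0 : z = 0 := by
    rw [Complex.norm_intCast] at hz_lt
    exact Int.abs_lt_one_iff.mp (by exact_mod_cast hz_lt)
  have hprime : Prime (p : ℤ) := Nat.prime_iff_prime_int.mp hp
  have hdvd : (p : ℤ) ∣ n * w * l ^ (p * d) :=
    (dvd_add_left (dvd_mul_right (p : ℤ) m)).mp ((dvd_zero _).trans (dvd_of_eq hz0.symm))
  have hnot : ∀ a : ℤ, a ≠ 0 → a.natAbs < p → ¬ (p : ℤ) ∣ a := fun a ha hlt h =>
    absurd (Nat.le_of_dvd (Int.natAbs_pos.mpr ha) (Int.natCast_dvd.mp h)) (by omega)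
  rcases hprime.dvd_or_dvd hdvd with h | h
  · exact (hprime.dvd_or_dvd h).elim hn (hnot w hw (by omega))
  · exact hnot l hl0 (by omega) (hprime.dvd_of_dvd_pow h)

/-- A Galois-invariant element of the group ring with nonzero constant coefficient does not evaluate
to zero. -/
theorem AddMonoidAlgebra.expEval_ne_zero_of_coeff_zero_ne_zero [Algebra L ℂ]
    {F : AddMonoidAlgebra ℤ L} (hF : ∀ (τ : L ≃ₐ[ℚ] L) (x : L), F.coeff (τ x) = F.coeff x)
    (h0 : F.coeff 0 ≠ 0) : expEval L F ≠ 0 := by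
  classical
  have h := intCast_add_sum_mul_exp_ne_zero (F.coeff.support.erase 0) (by simp) F.coeff
    (fun τ x hx => by simpa [hF] using hx) hF h0
  rw [expEval_apply, ← Finset.add_sum_erase _ _ (Finsupp.mem_support_iff.mpr h0)]
  simpa using h

/-- A nonzero Galois-invariant element of the group ring does not evaluate to zero. -/
theorem AddMonoidAlgebra.expEval_ne_zero [Algebra L ℂ]
    {F : AddMonoidAlgebra ℤ L} (hF : ∀ (τ : L ≃ₐ[ℚ] L) (x : L), F.coeff (τ x) = F.coeff x)
    (h0 : F ≠ 0) : expEval L F ≠ 0 := by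
  obtain ⟨y, hy⟩ : ∃ y, F.coeff y ≠ 0 := by
    by_contra! h
    exact h0 (AddMonoidAlgebra.ext (Finsupp.ext h))
  have hcoeff : ∀ x, (F * ∑ τ : L ≃ₐ[ℚ] L, single (-τ y) 1).coeff x =
      ∑ τ : L ≃ₐ[ℚ] L, F.coeff (x + τ y) := fun x => by
    simp [Finset.mul_sum, Finsupp.finsetSum_apply]
  have h := expEval_ne_zero_of_coeff_zero_ne_zero
    (F := F * ∑ τ : L ≃ₐ[ℚ] L, single (-τ y) 1) (fun σ x => ?_) ?_
  · rw [map_mul] at h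
    exact left_ne_zero_of_mul h
  · rw [hcoeff, hcoeff, ← Equiv.sum_comp (Equiv.mulLeft σ)]
    refine Finset.sum_congr rfl fun τ _ => ?_
    rw [Equiv.coe_mulLeft, AlgEquiv.mul_apply, ← map_add, hF]
  · simp [hcoeff, hF, hy]

/-- The exponential of a nonzero element of a Galois number field is transcendental. -/
theorem transcendental_exp_algebraMap [Algebra L ℂ] {x : L} (hx : x ≠ 0) :
    Transcendental ℤ (Complex.exp (algebraMap L ℂ x)) := by
  classical
  intro halg
  obtain ⟨P, hP0, hP⟩ := halg.exists_nonzero_coeff_and_aeval_eq_zero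
    (mem_nonZeroDivisors_of_ne_zero (Complex.exp_ne_zero _))
  let u : (L ≃ₐ[ℚ] L) → AddMonoidAlgebra ℤ L := fun τ => .single (τ x) 1
  have hne : ∀ τ, aeval (u τ) P ≠ 0 := fun τ h => by
    have hcoeff := congrArg (fun F : AddMonoidAlgebra ℤ L => F.coeff 0) h
    rw [aeval_eq_sum_range] at hcoeff
    refine hP0 ?_
    simpa [u, Finsupp.finsetSum_apply, Finsupp.single_apply, hx] using hcoeff
  refine AddMonoidAlgebra.expEval_ne_zero (F := ∏ τ, aeval (u τ) P) (fun σ y => ?_)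
    (Finset.prod_ne_zero_iff.mpr fun τ _ => hne τ) ?_
  · let e : L ≃+ L := σ.toRingEquiv.toAddEquiv
    have hfix : AddMonoidAlgebra.domCongr ℤ ℤ e (∏ τ, aeval (u τ) P) = ∏ τ, aeval (u τ) P := by
      rw [map_prod, ← Equiv.prod_comp (Equiv.mulLeft σ) fun τ => aeval (u τ) P]
      refine Finset.prod_congr rfl fun τ _ => ?_
      rw [← aeval_algHom_apply]
      simp [u, e]
    conv_lhs => rw [← hfix, AddMonoidAlgebra.coeff_domCongr]
    exact congrArg _ (σ.symm_apply_apply y)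
  · rw [map_prod]
    refine Finset.prod_eq_zero (Finset.mem_univ 1) ?_
    rw [← aeval_algHom_apply]
    simpa [u, AddMonoidAlgebra.expEval_single] using hP

end Galois

/-- The exponential of a nonzero algebraic number is transcendental. -/
theorem Complex.transcendental_exp_of_isAlgebraic {z : ℂ} (hz : IsAlgebraic ℚ z) (h0 : z ≠ 0) :
    Transcendental ℚ (Complex.exp z) := by
  let L := IntermediateField.adjoin ℚ ((minpoly ℚ z).rootSet ℂ)
  have hsplit : (minpoly ℚ z).IsSplittingField ℚ L :=
    IntermediateField.adjoin_rootSet_isSplittingField (IsAlgClosed.splits _)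
  have : FiniteDimensional ℚ L := IsSplittingField.finiteDimensional L (minpoly ℚ z)
  have : Normal ℚ L := Normal.of_isSplittingField (minpoly ℚ z)
  have : IsGalois ℚ L := ⟨⟩
  have hzL : z ∈ L := IntermediateField.subset_adjoin _ _ <| by
    rw [mem_rootSet]
    exact ⟨minpoly.ne_zero hz.isIntegral, minpoly.aeval ℚ z⟩
  intro h
  refine transcendental_exp_algebraMap (L := L) (x := ⟨z, hzL⟩)
    (by simpa [Subtype.ext_iff] using h0) ?_
  exact (IsFractionRing.isAlgebraic_iff ℤ ℚ ℂ).mpr h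

/-- For any algebraic number `α ≠ 0, 1`, the complex logarithm `log α` is
transcendental; in particular `ln α` is transcendental for every positive real
algebraic number `α ≠ 1`. -/
theorem log_transcendental_of_algebraic (α : ℂ) (halg : IsAlgebraic ℚ α)
    (h0 : α ≠ 0) (h1 : α ≠ 1) :
    Transcendental ℚ (Complex.log α) ∧
    ∀ β : ℝ, IsAlgebraic ℚ β → 0 < β → β ≠ 1 → Transcendental ℚ (Real.log β) := by
  have key : ∀ z : ℂ, IsAlgebraic ℚ z → z ≠ 0 → z ≠ 1 → Transcendental ℚ (Complex.log z) := by
    intro z hz hz0 hz1 hlog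
    have hlog0 : Complex.log z ≠ 0 := fun h =>
      hz1 (by rw [← Complex.exp_log hz0, h, Complex.exp_zero])
    refine Complex.transcendental_exp_of_isAlgebraic hlog hlog0 ?_
    rwa [Complex.exp_log hz0]
  refine ⟨key α halg h0 h1, fun β hβ hpos hne hlog => ?_⟩
  refine key β (hβ.algebraMap (A := ℂ)) (by exact_mod_cast hpos.ne') (by exact_mod_cast hne) ?_
  rw [← Complex.ofReal_log hpos.le]
  exact hlog.algebraMap (A := ℂ)
end

section
/- Let x be a real number with 0 < x < 1 that is algebraic over ℚ. Then S_{−1}(x) = ∑_{j=0}^∞ x^j/(j+1) equals −ln(1 − x)/x, and this number is transcendental over ℚ. -/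
open Polynomial Filter
open scoped Nat

theorem isIntegral_leadingCoeff_pow_mul_aeval {K : Type*} [Field K] {f g : ℤ[X]} {x : K} {k : ℕ}
    (hx : aeval x f = 0) (hg : g.natDegree ≤ k) :
    IsIntegral ℤ ((f.leadingCoeff : K) ^ k * aeval x g) := by
  have hfx : IsIntegral ℤ ((f.leadingCoeff : K) * x) := by
    simpa [zsmul_eq_mul] using isIntegral_leadingCoeff_smul f x hx
  rw [aeval_eq_sum_range' (Nat.lt_succ_of_le hg), Finset.mul_sum]
  refine IsIntegral.sum _ fun i hi ↦ ?_
  obtain ⟨j, rfl⟩ := Nat.exists_eq_add_of_le (Finset.mem_range_succ_iff.mp hi)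
  have h : (f.leadingCoeff : K) ^ (i + j) * g.coeff i • x ^ i =
      (f.leadingCoeff ^ j * g.coeff i : ℤ) * (f.leadingCoeff * x) ^ i := by
    push_cast [zsmul_eq_mul]
    ring
  rw [h]
  exact (isIntegral_algebraMap (R := ℤ) (A := K)).mul (hfx.pow i)

theorem exists_int_polynomial_aeval_eq_zero {K : Type*} [Field K] [Algebra ℚ K]
    [Algebra.IsAlgebraic ℚ K] (s : Finset K) (hs : 0 ∉ s) :
    ∃ f : ℤ[X], f.eval 0 ≠ 0 ∧ ∀ x ∈ s, aeval x f = 0 := by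
  have h (x : K) : ∃ f : ℤ[X], x ≠ 0 → f.coeff 0 ≠ 0 ∧ aeval x f = 0 := by
    by_cases hx : x = 0
    · exact ⟨0, fun h ↦ absurd hx h⟩
    · have hxa : IsAlgebraic ℤ x :=
        (IsFractionRing.isAlgebraic_iff ℤ ℚ K).mpr (Algebra.IsAlgebraic.isAlgebraic x)
      obtain ⟨f, hf⟩ :=
        hxa.exists_nonzero_coeff_and_aeval_eq_zero (mem_nonZeroDivisors_of_ne_zero hx)
      exact ⟨f, fun _ ↦ hf⟩
  choose f hf using h
  refine ⟨∏ x ∈ s, f x, ?_, fun x hx ↦ ?_⟩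
  · rw [eval_prod, Finset.prod_ne_zero_iff]
    intro x hx
    rw [← coeff_zero_eq_eval_zero]
    exact (hf x (ne_of_mem_of_not_mem hx hs)).1
  · rw [map_prod]
    exact Finset.prod_eq_zero hx (hf x (ne_of_mem_of_not_mem hx hs)).2

theorem exists_int_eq_of_isIntegral_of_forall_gal {K : Type*} [Field K] [Algebra ℚ K]
    [FiniteDimensional ℚ K] [IsGalois ℚ K] {y : K} (hy : IsIntegral ℤ y)
    (h : ∀ σ : Gal(K/ℚ), σ y = y) : ∃ z : ℤ, (z : K) = y := by
  obtain ⟨q, rfl⟩ := IntermediateField.mem_bot.mp ((IsGalois.mem_bot_iff_fixed y).mpr h)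
  obtain ⟨z, rfl⟩ := IsIntegrallyClosed.isIntegral_iff.mp
    ((isIntegral_algebraMap_iff (algebraMap ℚ K).injective).mp hy)
  exact ⟨z, by simp⟩

/-- A Galois-invariant integral combination of exponentials of algebraic numbers, in which
`exp 0` occurs, does not vanish. -/
theorem sum_mul_exp_ne_zero_of_gal_invariant {K : Type*} [Field K] [Algebra ℚ K]
    [FiniteDimensional ℚ K] [IsGalois ℚ K] (ι : K →+* ℂ) (m : K →₀ ℤ)
    (hm : ∀ (σ : Gal(K/ℚ)) x, m (σ x) = m x) (hm0 : m 0 ≠ 0) :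
    (m.sum fun x c ↦ c * Complex.exp (ι x)) ≠ 0 := by
  classical
  intro hsum
  set s := m.support.erase 0
  obtain ⟨f, hf0, hf⟩ := exists_int_polynomial_aeval_eq_zero s (by simp [s])
  obtain ⟨c, hc⟩ := LindemannWeierstrass.exp_polynomial_approx f hf0
  set a := f.leadingCoeff
  have hfne : f ≠ 0 := by rintro rfl; simp at hf0
  have ha0 : a ≠ 0 := leadingCoeff_ne_zero.mpr hfne
  set B : ℝ := |(a : ℝ)| ^ f.natDegree * |c|
  set C : ℝ := ∑ x ∈ s, |(m x : ℝ)|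
  have hlim : Tendsto (fun k : ℕ ↦ C * B * (B ^ k / k !)) atTop (nhds 0) := by
    simpa using (FloorSemiring.tendsto_pow_div_factorial_atTop B).const_mul (C * B)
  obtain ⟨k₀, hk₀⟩ := eventually_atTop.mp (hlim.eventually (gt_mem_nhds zero_lt_one))
  obtain ⟨p, hp, hpp⟩ := Nat.exists_infinite_primes
    (k₀ + (eval 0 f).natAbs + (m 0).natAbs + a.natAbs + 2)
  obtain ⟨n, hpn, g, hg, happ⟩ := hc p (by omega) hpp
  obtain ⟨z, hz⟩ := exists_int_eq_of_isIntegral_of_forall_gal (K := K)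
    (y := (a : K) ^ (p * f.natDegree) * ∑ x ∈ s, m x * aeval x g) (by
      rw [Finset.mul_sum]
      refine IsIntegral.sum _ fun x hx ↦ ?_
      rw [mul_left_comm]
      exact (isIntegral_algebraMap (R := ℤ) (A := K)).mul
        (isIntegral_leadingCoeff_pow_mul_aeval (hf x hx) (by omega))) (by
      intro σ
      rw [map_mul, map_pow, map_intCast, map_sum]
      congr 1
      refine Finset.sum_equiv σ.toEquiv (fun x ↦ by simp [s, hm]) fun x _ ↦ ?_
      have hσ := aeval_algHom_apply (σ.toAlgHom.restrictScalars ℤ) x g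
      simp only [AlgHom.restrictScalars_apply] at hσ
      simpa [hm] using Or.inl hσ.symm)
  set D : ℤ := a ^ (p * f.natDegree) * (n * m 0) + p * z with hD
  have hpZ : Prime (p : ℤ) := Nat.prime_iff_prime_int.mp hpp
  have hndvd {t : ℤ} (ht : t ≠ 0) (htp : t.natAbs < p) : ¬ (p : ℤ) ∣ t := fun h ↦
    htp.not_ge (Nat.le_of_dvd (Int.natAbs_pos.mpr ht) (Int.natCast_dvd.mp h))
  have hD0 : D ≠ 0 := by
    intro h
    have hdvd : (p : ℤ) ∣ a ^ (p * f.natDegree) * (n * m 0) :=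
      (Int.dvd_add_left (dvd_mul_right _ z)).mp (by rw [← hD, h]; exact dvd_zero _)
    rcases hpZ.dvd_or_dvd hdvd with h | h
    · exact hndvd ha0 (by omega) (hpZ.dvd_of_dvd_pow h)
    · rcases hpZ.dvd_or_dvd h with h | h
      · exact hpn h
      · exact hndvd hm0 (by omega) h
  have hsum' : (m 0 : ℂ) + ∑ x ∈ s, m x * Complex.exp (ι x) = 0 := by
    rw [Finsupp.sum, ← Finset.add_sum_erase _ _ (Finsupp.mem_support_iff.mpr hm0)] at hsum
    simpa using hsum
  have hDeq : (D : ℂ) =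
      -(a ^ (p * f.natDegree) * ∑ x ∈ s, m x * (n • Complex.exp (ι x) - p • aeval (ι x) g)) := by
    have hzι := congrArg ι hz
    have hι (x : K) : ι (aeval x g) = aeval (ι x) g :=
      (aeval_algHom_apply (ι.toIntAlgHom) x g).symm
    simp only [map_mul, map_pow, map_intCast, map_sum, hι] at hzι
    have hsplit : ∑ x ∈ s, (m x : ℂ) * (n • Complex.exp (ι x) - p • aeval (ι x) g) =
        n * ∑ x ∈ s, m x * Complex.exp (ι x) - p * ∑ x ∈ s, m x * aeval (ι x) g := by
      rw [Finset.mul_sum, Finset.mul_sum, ← Finset.sum_sub_distrib]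
      refine Finset.sum_congr rfl fun x _ ↦ ?_
      rw [zsmul_eq_mul, nsmul_eq_mul]
      ring
    rw [hsplit, eq_neg_of_add_eq_zero_right hsum', hD]
    push_cast
    rw [hzι]
    ring
  have hbound : |(D : ℝ)| ≤ C * B * (B ^ (p - 1) / (p - 1)!) := by
    have h1 : ‖∑ x ∈ s, (m x : ℂ) * (n • Complex.exp (ι x) - p • aeval (ι x) g)‖ ≤
        C * (|c| ^ p / (p - 1)!) := by
      rw [Finset.sum_mul]
      refine norm_sum_le_of_le _ fun x hx ↦ ?_
      rw [norm_mul, Complex.norm_intCast]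
      gcongr
      have hroot : ι x ∈ f.aroots ℂ := by
        rw [mem_aroots]
        refine ⟨hfne, ?_⟩
        have := aeval_algHom_apply (ι.toIntAlgHom) x f
        rw [hf x hx, map_zero] at this
        exact this
      refine (happ hroot).trans ?_
      gcongr ?_ / _
      exact (le_abs_self _).trans_eq (abs_pow c p)
    have hnorm := congrArg norm hDeq
    rw [norm_neg, norm_mul, norm_pow, Complex.norm_intCast, Complex.norm_intCast] at hnorm
    rw [hnorm]
    calc _ ≤ |(a : ℝ)| ^ (p * f.natDegree) * (C * (|c| ^ p / (p - 1)!)) := by gcongr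
      _ = C * (B * B ^ (p - 1)) / (p - 1)! := by
        rw [mul_pow_sub_one hpp.ne_zero, mul_pow, ← pow_mul, mul_comm f.natDegree]
        ring
      _ = _ := by ring
  have h1 : (1 : ℝ) ≤ |(D : ℝ)| := by exact_mod_cast Int.one_le_abs hD0
  linarith [hk₀ (p - 1) (by omega)]
/-- The **Hermite–Lindemann theorem**, for a number in a Galois number field. -/
theorem not_isAlgebraic_exp_of_isGalois {K : Type*} [Field K] [Algebra ℚ K]
    [FiniteDimensional ℚ K] [IsGalois ℚ K] (ι : K →+* ℂ) {a : K} (ha : a ≠ 0) :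
    ¬ IsAlgebraic ℤ (Complex.exp (ι a)) := by
  classical
  rintro ⟨P, hP0, hP⟩
  have : CharZero K := algebraRat.charZero K
  let E : AddMonoidAlgebra ℤ K →ₐ[ℤ] ℂ := AddMonoidAlgebra.lift ℤ ℂ K
    (Complex.expMonoidHom.comp ι.toAddMonoidHom.toMultiplicative)
  have hE (u) : E u = u.coeff.sum fun x c ↦ c * Complex.exp (ι x) := by
    simp only [E, AddMonoidAlgebra.lift_apply, zsmul_eq_mul]
    rfl
  let T (σ : Gal(K/ℚ)) : AddMonoidAlgebra ℤ K →+* AddMonoidAlgebra ℤ K :=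
    AddMonoidAlgebra.mapDomainRingHom ℤ (σ : K →+ K)
  let ν : AddMonoidAlgebra ℤ K →+* AddMonoidAlgebra ℤ K :=
    AddMonoidAlgebra.mapDomainRingHom ℤ (-AddMonoidHom.id K)
  let u (x : K) : AddMonoidAlgebra ℤ K := aeval (AddMonoidAlgebra.single x 1) P
  have hT (σ : Gal(K/ℚ)) (v : AddMonoidAlgebra ℤ K) (x : K) :
      (T σ v).coeff (σ x) = v.coeff x :=
    Finsupp.mapDomain_apply σ.injective _ _
  have hν (v : AddMonoidAlgebra ℤ K) (x : K) : (ν v).coeff (-x) = v.coeff x :=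
    Finsupp.mapDomain_apply neg_injective _ _
  have hTu (σ : Gal(K/ℚ)) (x : K) : T σ (u x) = u (σ x) := by
    have := aeval_algHom_apply (T σ).toIntAlgHom (AddMonoidAlgebra.single x 1) P
    refine this.symm.trans ?_
    simp only [u]
    congr 2
    exact AddMonoidAlgebra.mapDomain_single
  have hu (x : K) (hx : x ≠ 0) : u x ≠ 0 := by
    intro h
    apply hP0
    ext n
    have hn := congrArg (fun v ↦ v.coeff (n • x)) h
    simp only [u, aeval_eq_sum_range, AddMonoidAlgebra.single_pow] at hn
    simp [Finsupp.single_apply, hx] at hn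
    by_cases hnd : n ≤ P.natDegree
    · simpa using hn hnd
    · simp [coeff_eq_zero_of_natDegree_lt (not_le.mp hnd)]
  have hEu : E (u a) = 0 := by
    rw [← hP, ← aeval_algHom_apply]
    congr 2
    rw [hE]
    simp
  set N : AddMonoidAlgebra ℤ K := ∏ σ : Gal(K/ℚ), u (σ a) with hN
  have hN0 : N ≠ 0 := Finset.prod_ne_zero_iff.mpr fun σ _ ↦ hu _ (by simpa using ha)
  have hTN (σ : Gal(K/ℚ)) : T σ N = N := by
    rw [hN, map_prod]
    exact Fintype.prod_equiv (Equiv.mulLeft σ) _ _ fun τ ↦ hTu σ (τ a)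
  have hνN (σ : Gal(K/ℚ)) : T σ (ν N) = ν N := by
    ext x
    obtain ⟨y, rfl⟩ := σ.surjective x
    obtain ⟨y, rfl⟩ := neg_surjective y
    rw [hT, map_neg σ y, hν, hν]
    conv_rhs => rw [← hTN σ, hT]
  have hEN : E (N * ν N) = 0 := by
    rw [map_mul, hN, map_prod, Finset.prod_eq_zero (Finset.mem_univ 1) (by simpa using hEu),
      zero_mul]
  refine sum_mul_exp_ne_zero_of_gal_invariant ι (N * ν N).coeff (fun σ x ↦ ?_) ?_
    ((hE _).symm.trans hEN)
  · have h : T σ (N * ν N) = N * ν N := by rw [map_mul, hTN, hνN]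
    conv_lhs => rw [← h, hT]
  · rw [AddMonoidAlgebra.coeff_mul_apply_left]
    simp only [add_zero, hν]
    refine (Finset.sum_pos (fun x hx ↦ mul_self_pos.mpr (Finsupp.mem_support_iff.mp hx)) ?_).ne'
    rw [Finsupp.support_nonempty_iff]
    exact fun h ↦ hN0 (AddMonoidAlgebra.coeff_injective h)

/-- The **Hermite–Lindemann theorem**. -/
theorem transcendental_exp {z : ℂ} (hz : IsAlgebraic ℚ z) (hz0 : z ≠ 0) :
    Transcendental ℚ (Complex.exp z) := by
  intro h
  let K := IntermediateField.adjoin ℚ ((minpoly ℚ z).rootSet ℂ)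
  have hzK : z ∈ K := IntermediateField.subset_adjoin _ _
    (mem_rootSet.mpr ⟨minpoly.ne_zero hz.isIntegral, minpoly.aeval ℚ z⟩)
  have : (minpoly ℚ z).IsSplittingField ℚ K :=
    IntermediateField.adjoin_rootSet_isSplittingField (IsAlgClosed.splits _)
  have : FiniteDimensional ℚ K := IsSplittingField.finiteDimensional K (minpoly ℚ z)
  have : Normal ℚ K := Normal.of_isSplittingField (minpoly ℚ z)
  have : IsGalois ℚ K := {}
  refine not_isAlgebraic_exp_of_isGalois (algebraMap K ℂ) (a := ⟨z, hzK⟩) ?_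
    ((IsFractionRing.isAlgebraic_iff ℤ ℚ ℂ).mpr h)
  simpa [Subtype.ext_iff] using hz0

/-- For an algebraic real `x ∈ (0,1)`, the value
`S_{−1}(x) = ∑_{j≥0} x^j/(j+1)` equals `−ln(1−x)/x` and is transcendental. -/
theorem Sneg1_transcendental (x : ℝ) (h0 : 0 < x) (h1 : x < 1)
    (halg : IsAlgebraic ℚ x) :
    (∑' j : ℕ, x ^ j / ((j : ℝ) + 1)) = -Real.log (1 - x) / x ∧
    Transcendental ℚ (∑' j : ℕ, x ^ j / ((j : ℝ) + 1)) := by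
  have hsum : (∑' j : ℕ, x ^ j / ((j : ℝ) + 1)) = -Real.log (1 - x) / x := by
    rw [← (Real.hasSum_pow_div_log_of_abs_lt_one (abs_lt.mpr ⟨by linarith, h1⟩)).tsum_eq,
      ← tsum_div_const]
    refine tsum_congr fun j ↦ ?_
    field_simp
    exact (pow_succ x j).symm
  refine ⟨hsum, fun h ↦ ?_⟩
  rw [hsum] at h
  have hlog : IsAlgebraic ℚ (Real.log (1 - x)) := by
    have := (h.mul halg).neg
    rwa [div_mul_cancel₀ _ h0.ne', neg_neg] at this
  refine transcendental_exp (z := (Real.log (1 - x) : ℝ)) (hlog.algebraMap (A := ℂ)) ?_ ?_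
  · exact_mod_cast (Real.log_neg (by linarith) (by linarith)).ne
  · rw [← Complex.ofReal_exp, Real.exp_log (by linarith)]
    exact (isAlgebraic_one.sub halg).algebraMap (A := ℂ)
end

section
/- Let n ≥ 2 be an integer. Then there exist sequences of positive real numbers α = (α_i)_{i≥1}, β = (β_i)_{i≥1}, γ = (γ_i)_{i≥0} with ∑_{i=1}^∞ α_i² < ∞ and a bounded linear operator A on ℓ²(V∞) that is the weighted shift associated with (α, β, γ), such that (A*A)^n = (A*)^n A^n, while (A*A)^k ≠ (A*)^k A^k for every integer k ≥ 2 with k ≠ n; in particular A is injective (all weights are positive) and A is not quasinormal, i.e., A ∘ (A*A) ≠ (A*A) ∘ A. -/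
open ContinuousLinearMap

/-- The vertex set of the rootless directed tree `𝒯∞` with one branching
vertex: `Sum.inl k` encodes the vertex `−k` (for `k ≥ 0`) and `Sum.inr (i, j)`
encodes the vertex `(i+1, j+1)` (for `i, j ≥ 0`). -/
abbrev TreeVertex : Type := ℕ ⊕ ℕ × ℕ

/-- The Hilbert space `ℓ²(V∞)`. -/
abbrev TreeL2 : Type := lp (fun _ : TreeVertex => ℂ) 2

/-- The standard orthonormal basis vector `e_v` of `ℓ²(V∞)`. -/
noncomputable def treeBasis (v : TreeVertex) : TreeL2 := lp.single 2 v 1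

/-- `A` is the weighted shift on `𝒯∞` associated with the sequences of
positive weights `α = (α_{i+1})_{i≥0}`, `β = (β_{i+1})_{i≥0}`,
`γ = (γ_i)_{i≥0}`: `A e_{−(i+1)} = γ_i e_{−i}`,
`A e_0 = ∑_{i≥1} α_i e_{(i,1)}` (the sum converging in `ℓ²(V∞)`), and
`A e_{(i,j)} = β_i e_{(i,j+1)}`. -/
def IsTreeWeightedShift (α β γ : ℕ → ℝ) (A : TreeL2 →L[ℂ] TreeL2) : Prop :=
  (∀ i : ℕ, A (treeBasis (Sum.inl (i + 1))) = (γ i : ℂ) • treeBasis (Sum.inl i)) ∧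
  HasSum (fun i : ℕ => (α i : ℂ) • treeBasis (Sum.inr (i, 0)))
    (A (treeBasis (Sum.inl 0))) ∧
  (∀ i j : ℕ, A (treeBasis (Sum.inr (i, j))) = (β i : ℂ) • treeBasis (Sum.inr (i, j + 1)))

theorem pow_mul_eq_pow_mul_pow {M : Type*} [Monoid M] {a b : M}
    (h : a * (b * a) = b * a * a) (k : ℕ) : (b * a) ^ k = b ^ k * a ^ k := by
  induction k with
  | zero => simp
  | succ k ih =>
    have hc : Commute (a ^ k) (b * a) := Commute.pow_left h k
    rw [pow_succ, ih, mul_assoc, hc.eq, pow_succ b, pow_succ' a]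
    simp only [mul_assoc]

section Basis

theorem inner_treeBasis_left (v : TreeVertex) (f : TreeL2) : inner ℂ (treeBasis v) f = f v := by
  simp [treeBasis, lp.inner_single_left]

theorem treeBasis_apply (v w : TreeVertex) : treeBasis v w = if w = v then 1 else 0 := by
  simp [treeBasis, Pi.single_apply]

theorem treeBasis_ne_zero (v : TreeVertex) : treeBasis v ≠ 0 := fun h => by
  simpa [treeBasis_apply] using congrArg (fun f : TreeL2 => f v) h

theorem ext_treeBasis {S T : TreeL2 →L[ℂ] TreeL2} (h : ∀ v, S (treeBasis v) = T (treeBasis v)) :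
    S = T := by
  refine lp.ext_continuousLinearMap (by simp) fun v => ?_
  ext1
  simpa [treeBasis] using h v

theorem pow_apply_of_apply_eq_smul {T : TreeL2 →L[ℂ] TreeL2} {c : ℂ} {x : TreeL2}
    (h : T x = c • x) (k : ℕ) : (T ^ k) x = c ^ k • x := by
  induction k with
  | zero => simp
  | succ k ih => rw [pow_succ', mul_apply_eq_comp, ih, map_smul, h, smul_smul, pow_succ]

end Basis

namespace IsTreeWeightedShift

/-- The value `‖A ^ k e₋ₘ‖²` for a weighted shift with squared trunk weights `g` and
`S k = ‖A ^ (k + 1) e₀‖²`. -/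
def trunkNormSq (g S : ℕ → ℝ) : ℕ → ℕ → ℝ
  | 0, _ => 1
  | k + 1, 0 => S k
  | k + 1, m + 1 => g m * trunkNormSq g S k m

theorem trunkNormSq_congr {g g' S : ℕ → ℝ} (k : ℕ) {m : ℕ} (h : ∀ l < m, g l = g' l) :
    trunkNormSq g S k m = trunkNormSq g' S k m := by
  induction k generalizing m with
  | zero => simp [trunkNormSq]
  | succ k ih =>
    cases m with
    | zero => rfl
    | succ m => simp only [trunkNormSq, h m (by simp), ih fun l hl => h l (Nat.lt_succ_of_lt hl)]

theorem trunkNormSq_pos {g S : ℕ → ℝ} (k m : ℕ) (hg : ∀ l < m, 0 < g l) (hS : ∀ j, 0 < S j) :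
    0 < trunkNormSq g S k m := by
  induction k generalizing m with
  | zero => simp [trunkNormSq]
  | succ k ih =>
    cases m with
    | zero => exact hS k
    | succ m => exact mul_pos (hg m (by simp)) (ih m fun l hl => hg l (by lia))

theorem trunkNormSq_le_one {g S : ℕ → ℝ} (k m : ℕ) (hg : ∀ l < m, 0 < g l ∧ g l ≤ 1)
    (hS : ∀ j, 0 < S j) (hS' : ∀ j < k, S j ≤ 1) : trunkNormSq g S k m ≤ 1 := by
  induction k generalizing m with
  | zero => simp [trunkNormSq]
  | succ k ih =>
    cases m with
    | zero => exact hS' k (by simp)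
    | succ m =>
      exact mul_le_one₀ (hg m (by simp)).2
        (trunkNormSq_pos k m (fun l hl => (hg l (by lia)).1) hS).le
        (ih m (fun l hl => hg l (by lia)) fun j hj => hS' j (by lia))

/-- Squared trunk weights solving `g m ^ N = trunkNormSq g S N m`. -/
noncomputable def trunkWeightSq (S : ℕ → ℝ) (N m : ℕ) : ℝ :=
  trunkNormSq (fun l => if _ : l < m then trunkWeightSq S N l else 0) S N m ^ (N : ℝ)⁻¹
termination_by m

theorem trunkWeightSq_eq (S : ℕ → ℝ) (N m : ℕ) :
    trunkWeightSq S N m = trunkNormSq (trunkWeightSq S N) S N m ^ (N : ℝ)⁻¹ := by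
  rw [trunkWeightSq, trunkNormSq_congr (g' := trunkWeightSq S N) N fun l hl => dif_pos hl]

theorem trunkWeightSq_pos {S : ℕ → ℝ} (hS : ∀ j, 0 < S j) (N m : ℕ) :
    0 < trunkWeightSq S N m := by
  induction m using Nat.strong_induction_on with
  | _ m ih =>
    rw [trunkWeightSq_eq]
    exact Real.rpow_pos_of_pos (trunkNormSq_pos N m ih hS) _

theorem trunkWeightSq_le_one {S : ℕ → ℝ} (hS : ∀ j, 0 < S j) {N : ℕ}
    (hS' : ∀ j < N, S j ≤ 1) (m : ℕ) : trunkWeightSq S N m ≤ 1 := by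
  induction m using Nat.strong_induction_on with
  | _ m ih =>
    rw [trunkWeightSq_eq]
    exact Real.rpow_le_one (trunkNormSq_pos N m (fun l _ => trunkWeightSq_pos hS N l) hS).le
      (trunkNormSq_le_one N m (fun l hl => ⟨trunkWeightSq_pos hS N l, ih l hl⟩) hS hS')
      (by positivity)

theorem trunkWeightSq_pow {S : ℕ → ℝ} (hS : ∀ j, 0 < S j) {N : ℕ} (hN : N ≠ 0) (m : ℕ) :
    trunkWeightSq S N m ^ N = trunkNormSq (trunkWeightSq S N) S N m := by
  rw [trunkWeightSq_eq, Real.rpow_inv_natCast_pow _ hN]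
  exact (trunkNormSq_pos N m (fun l _ => trunkWeightSq_pos hS N l) hS).le

section Adjoint

variable {α β γ : ℕ → ℝ} {A : TreeL2 →L[ℂ] TreeL2}

theorem apply_root_apply (hA : IsTreeWeightedShift α β γ A) (w : TreeVertex) :
    A (treeBasis (Sum.inl 0)) w = ∑' i, if w = Sum.inr (i, 0) then (α i : ℂ) else 0 := by
  have h := hA.2.1.mapL (innerSL ℂ (treeBasis w))
  rw [innerSL_apply_apply, inner_treeBasis_left] at h
  rw [← h.tsum_eq]
  simp [inner_treeBasis_left, treeBasis_apply]

theorem adjoint_apply_apply (A : TreeL2 →L[ℂ] TreeL2) (v w : TreeVertex) :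
    adjoint A (treeBasis w) v = starRingEnd ℂ (A (treeBasis v) w) := by
  rw [← inner_treeBasis_left, adjoint_inner_right, ← inner_conj_symm, inner_treeBasis_left]

theorem adjoint_trunk (hA : IsTreeWeightedShift α β γ A) (i : ℕ) :
    adjoint A (treeBasis (Sum.inl i)) = (γ i : ℂ) • treeBasis (Sum.inl (i + 1)) := by
  ext v
  rw [adjoint_apply_apply]
  rcases v with (_ | m) | ⟨p, q⟩ <;>
  simp [hA.1, hA.2.2, hA.apply_root_apply, treeBasis_apply, apply_ite, eq_comm, -Complex.coe_smul]
  grind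

theorem adjoint_branch_zero (hA : IsTreeWeightedShift α β γ A) (i : ℕ) :
    adjoint A (treeBasis (Sum.inr (i, 0))) = (α i : ℂ) • treeBasis (Sum.inl 0) := by
  ext v
  rw [adjoint_apply_apply]
  rcases v with (_ | m) | ⟨p, q⟩ <;>
  simp [hA.1, hA.2.2, hA.apply_root_apply, treeBasis_apply, -Complex.coe_smul]

theorem adjoint_branch_succ (hA : IsTreeWeightedShift α β γ A) (i j : ℕ) :
    adjoint A (treeBasis (Sum.inr (i, j + 1))) = (β i : ℂ) • treeBasis (Sum.inr (i, j)) := by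
  ext v
  rw [adjoint_apply_apply]
  rcases v with (_ | m) | ⟨p, q⟩ <;>
  simp [hA.1, hA.2.2, hA.apply_root_apply, treeBasis_apply, apply_ite, eq_comm, -Complex.coe_smul]
  grind

theorem adjoint_pow_mul_pow_succ_apply (A : TreeL2 →L[ℂ] TreeL2) (k : ℕ) (x : TreeL2) :
    (adjoint A ^ (k + 1) * A ^ (k + 1)) x = adjoint A ((adjoint A ^ k * A ^ k) (A x)) := by
  rw [pow_succ' (adjoint A), pow_succ A]
  rfl

theorem adjoint_pow_mul_pow_branch (hA : IsTreeWeightedShift α β γ A) (k i j : ℕ) :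
    (adjoint A ^ k * A ^ k) (treeBasis (Sum.inr (i, j))) =
      (((β i ^ 2) ^ k : ℝ) : ℂ) • treeBasis (Sum.inr (i, j)) := by
  induction k generalizing j with
  | zero => simp
  | succ k ih =>
    rw [adjoint_pow_mul_pow_succ_apply, hA.2.2, map_smul, ih, map_smul, map_smul,
      hA.adjoint_branch_succ, smul_smul, smul_smul]
    congr 1
    push_cast
    ring

theorem adjoint_pow_mul_pow_trunk (hA : IsTreeWeightedShift α β γ A) {S : ℕ → ℝ}
    (hS : ∀ k, HasSum (fun i => α i ^ 2 * (β i ^ 2) ^ k) (S k)) (k m : ℕ) :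
    (adjoint A ^ k * A ^ k) (treeBasis (Sum.inl m)) =
      (trunkNormSq (fun l => γ l ^ 2) S k m : ℂ) • treeBasis (Sum.inl m) := by
  induction k generalizing m with
  | zero => simp [trunkNormSq]
  | succ k ih =>
    rw [adjoint_pow_mul_pow_succ_apply]
    cases m with
    | zero =>
      have h := hA.2.1.mapL ((adjoint A).comp (adjoint A ^ k * A ^ k))
      have h' := (Complex.hasSum_ofReal.2 (hS k)).smul_const (treeBasis (Sum.inl 0))
      refine h.unique (h'.congr_fun fun i => ?_)
      rw [map_smul, comp_apply, hA.adjoint_pow_mul_pow_branch, map_smul, hA.adjoint_branch_zero,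
        smul_smul, smul_smul]
      congr 1
      push_cast
      ring
    | succ m =>
      rw [hA.1, map_smul, ih, map_smul, map_smul, hA.adjoint_trunk, smul_smul, smul_smul]
      congr 1
      simp only [trunkNormSq]
      push_cast
      ring

theorem adjoint_mul_self_branch (hA : IsTreeWeightedShift α β γ A) (i j : ℕ) :
    (adjoint A * A) (treeBasis (Sum.inr (i, j))) =
      ((β i ^ 2 : ℝ) : ℂ) • treeBasis (Sum.inr (i, j)) := by
  simpa using hA.adjoint_pow_mul_pow_branch 1 i j

theorem adjoint_mul_self_trunk (hA : IsTreeWeightedShift α β γ A) {S : ℕ → ℝ}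
    (hS : ∀ k, HasSum (fun i => α i ^ 2 * (β i ^ 2) ^ k) (S k)) (m : ℕ) :
    (adjoint A * A) (treeBasis (Sum.inl m)) =
      (trunkNormSq (fun l => γ l ^ 2) S 1 m : ℂ) • treeBasis (Sum.inl m) := by
  simpa using hA.adjoint_pow_mul_pow_trunk hS 1 m

end Adjoint

end IsTreeWeightedShift

theorem injective_of_adjoint_mul_self_diagonal {A : TreeL2 →L[ℂ] TreeL2}
    (h : ∀ v, ∃ c : ℝ, c ≠ 0 ∧ (adjoint A * A) (treeBasis v) = (c : ℂ) • treeBasis v) :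
    Function.Injective A := by
  refine (injective_iff_map_eq_zero A).2 fun f hf => ?_
  ext v
  obtain ⟨c, hc, hv⟩ := h v
  have h0 : inner ℂ ((adjoint A * A) (treeBasis v)) f = 0 := by
    rw [mul_apply_eq_comp, adjoint_inner_left, hf, inner_zero_right]
  rw [hv, inner_smul_left, inner_treeBasis_left] at h0
  simpa [hc] using h0

section Construction

/-- The unit vector `∑ i, α i • e_{(i, 0)}`, for square-summable `α`. -/
noncomputable def rootImage {α : ℕ → ℝ} (hα : Summable fun i => α i ^ 2) : TreeL2 :=
  ⟨Sum.elim (fun _ => 0) fun p => if p.2 = 0 then (α p.1 : ℂ) else 0, by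
    refine memℓp_gen ?_
    have hinj : Function.Injective fun i : ℕ => (Sum.inr (i, 0) : TreeVertex) :=
      fun i j h => by simpa using h
    refine (hinj.summable_iff ?_).1 ?_
    · rintro (m | ⟨i, j⟩) hx
      · simp
      · have : j ≠ 0 := by rintro rfl; exact hx ⟨i, rfl⟩
        simp [this]
    · simpa [Function.comp_def] using hα⟩

theorem hasSum_rootImage {α : ℕ → ℝ} (hα : Summable fun i => α i ^ 2) :
    HasSum (fun i : ℕ => (α i : ℂ) • treeBasis (Sum.inr (i, 0))) (rootImage hα) := by
  have hinj : Function.Injective fun i : ℕ => (Sum.inr (i, 0) : TreeVertex) :=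
    fun i j h => by simpa using h
  have h := lp.hasSum_single (by simp) (rootImage hα)
  rw [← hinj.hasSum_iff] at h
  · refine h.congr_fun fun i => ?_
    simp [rootImage, treeBasis, ← lp.single_smul]
  · rintro (m | ⟨i, j⟩) hx
    · simp [rootImage]
    · have : j ≠ 0 := by rintro rfl; exact hx ⟨i, rfl⟩
      simp [rootImage, this]

theorem norm_rootImage {α : ℕ → ℝ} (hα : HasSum (fun i => α i ^ 2) 1) :
    ‖rootImage hα.summable‖ = 1 := by
  have h := (hasSum_rootImage hα.summable).mapL (innerSL ℂ (rootImage hα.summable))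
  have h' : HasSum (fun i => ((α i ^ 2 : ℝ) : ℂ)) ((1 : ℝ) : ℂ) := Complex.hasSum_ofReal.2 hα
  have hi : inner ℂ (rootImage hα.summable) (rootImage hα.summable) = (1 : ℂ) := by
    rw [innerSL_apply_apply] at h
    rw [h.unique (h'.congr_fun fun i => ?_)]
    · simp
    · rw [map_smul, innerSL_apply_apply, ← inner_conj_symm, inner_treeBasis_left]
      simp [rootImage, sq]
  rw [inner_self_eq_norm_sq_to_K] at hi
  have : ‖rootImage hα.summable‖ ^ 2 = 1 := Complex.ofReal_injective (by simpa using hi)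
  exact (pow_eq_one_iff_of_nonneg (norm_nonneg _) two_ne_zero).1 this

/-- The normalized images of the basis vectors under a weighted shift. -/
noncomputable def childVector {α : ℕ → ℝ} (hα : Summable fun i => α i ^ 2) : TreeVertex → TreeL2
  | Sum.inl 0 => rootImage hα
  | Sum.inl (m + 1) => treeBasis (Sum.inl m)
  | Sum.inr (i, j) => treeBasis (Sum.inr (i, j + 1))

theorem orthonormal_childVector {α : ℕ → ℝ} (hα : HasSum (fun i => α i ^ 2) 1) :
    Orthonormal ℂ (childVector hα.summable) := by
  have hb (v : TreeVertex) : ‖treeBasis v‖ = 1 := by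
    rw [treeBasis, lp.norm_single (by simp)]; simp
  refine ⟨?_, ?_⟩
  · rintro ((_ | m) | ⟨i, j⟩)
    · exact norm_rootImage hα
    · exact hb _
    · exact hb _
  · have hr (v : TreeVertex) (f : TreeL2) (h : f v = 0) : inner ℂ f (treeBasis v) = 0 := by
      rw [← inner_conj_symm, inner_treeBasis_left, h, map_zero]
    rintro ((_ | m) | ⟨i, j⟩) ((_ | m') | ⟨i', j'⟩) hne
    · exact absurd rfl hne
    · exact hr _ (rootImage hα.summable) (by simp [rootImage])
    · exact hr _ (rootImage hα.summable) (by simp [rootImage])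
    all_goals
      refine (inner_treeBasis_left _ _).trans ?_
      simp [childVector, rootImage, treeBasis_apply] at hne ⊢
    · exact hne
    · exact hne

theorem exists_isTreeWeightedShift {α β γ : ℕ → ℝ} (hα : HasSum (fun i => α i ^ 2) 1)
    {K : ℝ} (hK : 1 ≤ K) (hβ : ∀ i, |β i| ≤ K) (hγ : ∀ i, |γ i| ≤ K) :
    ∃ A : TreeL2 →L[ℂ] TreeL2, IsTreeWeightedShift α β γ A := by
  let d : TreeVertex → ℝ := Sum.elim (fun m => Nat.casesOn m 1 γ) fun p => β p.1
  have hd (v : TreeVertex) : ‖(d v : ℂ) • ContinuousLinearMap.id ℂ ℂ‖ ≤ K := by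
    rw [norm_smul, norm_id, mul_one, Complex.norm_real, Real.norm_eq_abs]
    rcases v with (_ | m) | p
    · simpa [d] using hK
    · exact hγ m
    · exact hβ p.1
  let D : TreeL2 →L[ℂ] TreeL2 := lp.mapCLM 2 _ (zero_le_one.trans hK) hd
  have hD (v : TreeVertex) : D (treeBasis v) = (d v : ℂ) • treeBasis v := by
    ext w
    by_cases h : w = v
    · subst h; simp [D, treeBasis_apply, -Complex.coe_smul]
    · simp [D, treeBasis_apply, h, -Complex.coe_smul]
  let U := (orthonormal_childVector hα).orthogonalFamily.linearIsometry
  have hU (v : TreeVertex) : U (treeBasis v) = childVector hα.summable v := by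
    simp [U, treeBasis]
  refine ⟨U.toContinuousLinearMap.comp D, fun i => ?_, ?_, fun i j => ?_⟩
  · simp [hD, hU, d, childVector, -Complex.coe_smul]
  · simpa [hD, hU, d, childVector] using hasSum_rootImage hα.summable
  · simp [hD, hU, d, childVector, -Complex.coe_smul]

end Construction

section Moments

/-- The mean of the `r`-th powers of `1 / 2` and `3 / 2`. -/
noncomputable def rpowMean (r : ℝ) : ℝ := ((1 / 2 : ℝ) ^ r + (3 / 2 : ℝ) ^ r) / 2

theorem rpowMean_lt_one {r : ℝ} (h0 : 0 < r) (h1 : r < 1) : rpowMean r < 1 := by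
  have h := (Real.strictConcaveOn_rpow h0 h1).2 (Set.mem_Ici.2 (by norm_num : (0 : ℝ) ≤ 1 / 2))
    (Set.mem_Ici.2 (by norm_num : (0 : ℝ) ≤ 3 / 2)) (by norm_num)
    (by norm_num : (0 : ℝ) < 1 / 2) (by norm_num : (0 : ℝ) < 1 / 2) (by norm_num)
  norm_num at h
  rw [rpowMean]
  norm_num
  linarith

theorem one_lt_rpowMean {r : ℝ} (h1 : 1 < r) : 1 < rpowMean r := by
  have h := (strictConvexOn_rpow h1).2 (Set.mem_Ici.2 (by norm_num : (0 : ℝ) ≤ 1 / 2))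
    (Set.mem_Ici.2 (by norm_num : (0 : ℝ) ≤ 3 / 2)) (by norm_num)
    (by norm_num : (0 : ℝ) < 1 / 2) (by norm_num : (0 : ℝ) < 1 / 2) (by norm_num)
  norm_num at h
  rw [rpowMean]
  norm_num
  linarith

theorem rpowMean_pos (r : ℝ) : 0 < rpowMean r := by
  unfold rpowMean
  positivity

theorem rpowMean_zero : rpowMean 0 = 1 := by norm_num [rpowMean]

theorem rpowMean_one : rpowMean 1 = 1 := by norm_num [rpowMean]

theorem rpowMean_le_one {r : ℝ} (h0 : 0 ≤ r) (h1 : r < 1) : rpowMean r ≤ 1 := by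
  rcases h0.eq_or_lt with rfl | h0
  · exact rpowMean_zero.le
  · exact (rpowMean_lt_one h0 h1).le

theorem hasSum_geometric_mul_ite_pow (a b : ℝ) (k : ℕ) :
    HasSum (fun i : ℕ => (1 / 2 : ℝ) ^ (i + 1) * (if i = 0 then a else b) ^ k)
      ((a ^ k + b ^ k) / 2) := by
  have h := (hasSum_geometric_two.mul_left (b ^ k / 2)).add
    (hasSum_ite_eq 0 ((a ^ k - b ^ k) / 2))
  convert! h using 1
  · ext i
    split_ifs with hi
    · subst hi; ring
    · ring
  · ring

end Moments

/-- For every `n ≥ 2` there is a bounded weighted shift `A` on the rootless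
directed tree `𝒯∞` with positive weights such that `(A*A)^n = (A*)^n A^n`
while `(A*A)^k ≠ (A*)^k A^k` for every integer `k ≥ 2` with `k ≠ n`; in
particular `A` is injective and not quasinormal. -/
theorem exists_treeShift_single_power_equality (n : ℕ) (hn : 2 ≤ n) :
    ∃ (α β γ : ℕ → ℝ) (A : TreeL2 →L[ℂ] TreeL2),
      (∀ i, 0 < α i) ∧ (∀ i, 0 < β i) ∧ (∀ i, 0 < γ i) ∧
      (Summable fun i : ℕ => (α i) ^ 2) ∧
      IsTreeWeightedShift α β γ A ∧
      (adjoint A * A) ^ n = (adjoint A) ^ n * A ^ n ∧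
      (∀ k : ℕ, 2 ≤ k → k ≠ n →
        (adjoint A * A) ^ k ≠ (adjoint A) ^ k * A ^ k) ∧
      Function.Injective A ∧
      A * (adjoint A * A) ≠ (adjoint A * A) * A := by
  obtain ⟨N, rfl⟩ : ∃ N, n = N + 1 := ⟨n - 1, by lia⟩
  have hN : N ≠ 0 := by lia
  have hN' : (0 : ℝ) < N := by positivity
  set a : ℝ := (1 / 2 : ℝ) ^ (N : ℝ)⁻¹
  set b : ℝ := (3 / 2 : ℝ) ^ (N : ℝ)⁻¹
  have ha0 : 0 < a := by positivity
  have hb0 : 0 < b := by positivity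
  let S : ℕ → ℝ := fun k => rpowMean (k / N)
  have hSpos (j : ℕ) : 0 < S j := rpowMean_pos _
  have hSle (j : ℕ) (hj : j < N) : S j ≤ 1 :=
    rpowMean_le_one (by positivity) ((div_lt_one hN').2 (by exact_mod_cast hj))
  have hS0 : S 0 = 1 := by simp [S, rpowMean_zero]
  have hSN : S N = 1 := by simp [S, hN, rpowMean_one]
  have hSne (k : ℕ) (hk : k ≠ 0) (hkN : k ≠ N) : S k ≠ 1 := by
    rcases hkN.lt_or_gt with h | h
    · exact (rpowMean_lt_one (by positivity) ((div_lt_one hN').2 (by exact_mod_cast h))).ne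
    · exact (one_lt_rpowMean ((one_lt_div hN').2 (by exact_mod_cast h))).ne'
  let α : ℕ → ℝ := fun i => √((1 / 2) ^ (i + 1))
  let β : ℕ → ℝ := fun i => √(if i = 0 then a else b)
  let g : ℕ → ℝ := IsTreeWeightedShift.trunkWeightSq S N
  let γ : ℕ → ℝ := fun m => √(g m)
  have hg0 (m : ℕ) : 0 < g m := IsTreeWeightedShift.trunkWeightSq_pos hSpos N m
  have hβ0 (i : ℕ) : 0 < if i = 0 then a else b := by split_ifs <;> assumption
  have hα2 (i : ℕ) : α i ^ 2 = (1 / 2) ^ (i + 1) := Real.sq_sqrt (by positivity)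
  have hβ2 (i : ℕ) : β i ^ 2 = if i = 0 then a else b := Real.sq_sqrt (hβ0 i).le
  have hγ2 : (fun m => γ m ^ 2) = g := funext fun m => Real.sq_sqrt (hg0 m).le
  have hS (k : ℕ) : HasSum (fun i => α i ^ 2 * (β i ^ 2) ^ k) (S k) := by
    have hpow (x : ℝ) (hx : 0 ≤ x) : x ^ ((k : ℝ) / N) = (x ^ (N : ℝ)⁻¹) ^ k := by
      rw [div_eq_inv_mul, Real.rpow_mul_natCast hx]
    simp only [hα2, hβ2, S, rpowMean]
    rw [hpow _ (by norm_num), hpow _ (by norm_num)]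
    exact hasSum_geometric_mul_ite_pow a b k
  have hα : HasSum (fun i => α i ^ 2) 1 := by simpa [hS0] using hS 0
  obtain ⟨A, hA⟩ := exists_isTreeWeightedShift (β := β) (γ := γ) hα
    (K := max 1 (max (√a) (√b))) (le_max_left _ _)
    (fun i => by
      rw [abs_of_nonneg (Real.sqrt_nonneg _)]
      refine le_max_of_le_right ?_
      by_cases hi : i = 0 <;> simp [hi])
    (fun i => by
      rw [abs_of_nonneg (Real.sqrt_nonneg _)]
      exact le_max_of_le_left
        (Real.sqrt_le_one.2 (IsTreeWeightedShift.trunkWeightSq_le_one hSpos hSle i)))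
  have hT := hA.adjoint_pow_mul_pow_trunk hS
  have hT1 := hA.adjoint_mul_self_trunk hS
  rw [hγ2] at hT hT1
  have hne (k : ℕ) (hk2 : 2 ≤ k) (hkn : k ≠ N + 1) :
      (adjoint A * A) ^ k ≠ adjoint A ^ k * A ^ k := fun h => by
    obtain ⟨k, rfl⟩ : ∃ l, k = l + 1 := ⟨k - 1, by lia⟩
    have h0 := congrArg (fun T : TreeL2 →L[ℂ] TreeL2 => T (treeBasis (Sum.inl 0))) h
    simp only [hT, pow_apply_of_apply_eq_smul (hT1 0)] at h0
    have h1 := smul_left_injective ℂ (treeBasis_ne_zero (Sum.inl 0)) h0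
    simp only [IsTreeWeightedShift.trunkNormSq, hS0, Complex.ofReal_one, one_pow] at h1
    exact hSne k (by lia) (by lia) (by exact_mod_cast h1.symm)
  refine ⟨α, β, γ, A, fun i => by positivity, fun i => Real.sqrt_pos.2 (hβ0 i),
    fun i => Real.sqrt_pos.2 (hg0 i), hα.summable, hA, ext_treeBasis ?_, hne,
    injective_of_adjoint_mul_self_diagonal ?_,
    fun h => hne (N + 2) (Nat.le_add_left 2 N) (Nat.succ_ne_self _) (pow_mul_eq_pow_mul_pow h _)⟩
  · rintro ((_ | m) | ⟨i, j⟩)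
    · rw [hT, pow_apply_of_apply_eq_smul (hT1 0)]
      simp [IsTreeWeightedShift.trunkNormSq, hS0, hSN]
    · rw [hT, pow_apply_of_apply_eq_smul (hT1 (m + 1))]
      simp only [IsTreeWeightedShift.trunkNormSq, mul_one]
      rw [← IsTreeWeightedShift.trunkWeightSq_pow hSpos hN m]
      push_cast
      rw [pow_succ']
    · rw [hA.adjoint_pow_mul_pow_branch,
        pow_apply_of_apply_eq_smul (hA.adjoint_mul_self_branch i j), Complex.ofReal_pow (β i ^ 2)]
  · rintro (m | ⟨i, j⟩)
    · exact ⟨_, (IsTreeWeightedShift.trunkNormSq_pos 1 m (fun l _ => hg0 l) hSpos).ne', hT1 m⟩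
    · exact ⟨_, by rw [hβ2]; exact (hβ0 i).ne', hA.adjoint_mul_self_branch i j⟩
end
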